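/- Let X* = [0,1] \ ⋃_{x₀ ∈ B₁} I(x₀), where the union is over all balanced dyadic rationals x₀ of generation 1. Then: (i) T maps X* onto [0, 1/2], i.e. T(X*) = [0, 1/2]; and (ii) T is strictly increasing on X* ∩ [0, 1/2), i.e. for all x, x' ∈ X* ∩ [0, 1/2) with x < x', T(x) < T(x'). -/

import Mathlib

open Set MeasureTheory ENNReal

/-- `phi x` is the distance from `x` to the nearest integer. -/
noncomputable def phi (x : ℝ) : ℝ := |x - (round x : ℤ)|

/-- The Takagi function. -/
noncomputable def T (x : ℝ) : ℝ := ∑' n : ℕ, phi (2 ^ n * x) / 2 ^ n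

/-- The `n`-th binary digit of `x` (terminating expansion for dyadic rationals). -/
noncomputable def eps (n : ℕ) (x : ℝ) : ℤ := ⌊2 ^ n * x⌋ - 2 * ⌊2 ^ (n - 1) * x⌋

/-- `D k x = ∑_{j=1}^k (-1)^{ε_j(x)}`, the excess of 0 digits over 1 digits. -/
noncomputable def D (k : ℕ) (x : ℝ) : ℤ := ∑ j ∈ Finset.Icc 1 k, (1 - 2 * eps j x)

/-- The level set of the Takagi function at level `y`. -/
def L (y : ℝ) : Set ℝ := {x | x ∈ Set.Icc (0:ℝ) 1 ∧ T x = y}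

/-- `x` is a balanced dyadic rational of order `m`. -/
def BalancedOfOrder (x : ℝ) (m : ℕ) : Prop :=
  x ∈ Set.Ico (0:ℝ) 1 ∧ (∃ k : ℤ, x = (k : ℝ) / 2 ^ (2 * m)) ∧ D (2 * m) x = 0

/-- The generation of a balanced dyadic rational of order `m`:
the number of indices `1 ≤ j ≤ 2m` with `D j x = 0`. -/
noncomputable def generation (x : ℝ) (m : ℕ) : ℕ :=
  ((Finset.Icc 1 (2 * m)).filter (fun j => D j x = 0)).card

/-- A balanced dyadic rational of order `m` is leading if `D j x ≥ 0` for all `1 ≤ j ≤ 2m`. -/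
def Leading (x : ℝ) (m : ℕ) : Prop := ∀ j ∈ Finset.Icc 1 (2 * m), 0 ≤ D j x

/-- The equivalence relation whose classes are the local level sets. -/
def locSetoid : Setoid ℝ where
  r x x' := ∀ n : ℕ, 1 ≤ n → |D n x| = |D n x'|
  iseqv := ⟨fun _ _ _ => rfl, fun h n hn => (h n hn).symm,
    fun h g n hn => (h n hn).trans (g n hn)⟩

/-- The set of local level sets contained in `L y`: the image of `L y ∩ [0,1)`
under the quotient map of `locSetoid`. -/
def locClasses (y : ℝ) : Set (Quotient locSetoid) :=
  Quotient.mk locSetoid '' (L y ∩ Set.Ico (0:ℝ) 1)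

/-- `X* = [0,1]` minus the union of all intervals `I(x₀)` over first-generation
balanced dyadic rationals `x₀`. -/
def Xstar : Set ℝ :=
  Set.Icc (0:ℝ) 1 \
    ⋃ (x₀ : ℝ) (m : ℕ) (_ : BalancedOfOrder x₀ m ∧ generation x₀ m = 1),
      Set.Icc x₀ (x₀ + (1:ℝ) / 4 ^ m)

/-! ### The distance to the nearest integer -/

theorem phi_nonneg (x : ℝ) : 0 ≤ phi x := abs_nonneg _

theorem phi_le_half (x : ℝ) : phi x ≤ 1 / 2 := abs_sub_round x

theorem continuous_phi : Continuous phi := by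
  have h : LipschitzWith 1 phi := by
    refine LipschitzWith.of_le_add fun x y => ?_
    have h1 : phi x ≤ |x - (round y : ℤ)| := round_le x (round y)
    have h2 : |x - (round y : ℤ)| ≤ |y - (round y : ℤ)| + |x - y| := by
      have := abs_add_le (y - (round y : ℤ)) (x - y)
      rwa [show y - (round y : ℤ) + (x - y) = x - (round y : ℤ) by ring] at this
    rw [Real.dist_eq]
    exact h1.trans h2
  exact h.continuous

theorem phi_add_int (x : ℝ) (k : ℤ) : phi (x + k) = phi x := by
  simp [phi, round_add_intCast]

theorem phi_of_le_half {x : ℝ} (h0 : 0 ≤ x) (h1 : x ≤ 1 / 2) : phi x = x := by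
  rw [phi, abs_sub_round_eq_min]
  rw [Int.fract_eq_self.2 ⟨h0, by linarith⟩]
  exact min_eq_left (by linarith)

theorem phi_of_half_le {x : ℝ} (h0 : 1 / 2 ≤ x) (h1 : x ≤ 1) : phi x = 1 - x := by
  rcases h1.eq_or_lt with rfl | h1
  · simp [phi]
  rw [phi, abs_sub_round_eq_min]
  rw [Int.fract_eq_self.2 ⟨by linarith, h1⟩]
  exact min_eq_right (by linarith)

/-! ### The Takagi function -/

theorem phi_div_le (x : ℝ) (n : ℕ) : phi (2 ^ n * x) / 2 ^ n ≤ 1 / 2 / 2 ^ n := by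
  gcongr
  exact phi_le_half _

theorem phi_div_nonneg (x : ℝ) (n : ℕ) : 0 ≤ phi (2 ^ n * x) / 2 ^ n :=
  div_nonneg (phi_nonneg _) (by positivity)

theorem summable_phi (x : ℝ) : Summable fun n : ℕ => phi (2 ^ n * x) / 2 ^ n :=
  Summable.of_nonneg_of_le (phi_div_nonneg x) (phi_div_le x) (summable_geometric_two' 1)

theorem T_nonneg (x : ℝ) : 0 ≤ T x := tsum_nonneg (phi_div_nonneg x)

theorem T_le_one (x : ℝ) : T x ≤ 1 :=
  ((summable_phi x).tsum_le_tsum (phi_div_le x) (summable_geometric_two' 1)).trans_eq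
    (tsum_geometric_two' 1)

theorem continuous_T : Continuous T := by
  refine continuous_tsum (u := fun n : ℕ => (1 : ℝ) / 2 / 2 ^ n) (fun n => ?_)
    (summable_geometric_two' 1) fun n x => ?_
  · exact (continuous_phi.comp (continuous_const.mul continuous_id)).div_const _
  · rw [Real.norm_of_nonneg (phi_div_nonneg x n)]
    exact phi_div_le x n

theorem T_eq (x : ℝ) : T x = phi x + T (2 * x) / 2 := by
  rw [T, (summable_phi x).tsum_eq_zero_add, T, ← tsum_div_const]
  congr 1
  · simp
  · refine tsum_congr fun n => ?_
    rw [show (2 : ℝ) ^ (n + 1) * x = 2 ^ n * (2 * x) by ring, pow_succ, div_div]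

theorem T_add_int (x : ℝ) (k : ℤ) : T (x + k) = T x := by
  refine tsum_congr fun n => ?_
  have := phi_add_int (2 ^ n * x) (2 ^ n * k)
  push_cast at this
  rw [mul_add, this]

theorem T_of_le_half {x : ℝ} (h0 : 0 ≤ x) (h1 : x ≤ 1 / 2) : T x = x + T (2 * x) / 2 := by
  rw [T_eq, phi_of_le_half h0 h1]

theorem T_of_half_le {x : ℝ} (h0 : 1 / 2 ≤ x) (h1 : x ≤ 1) :
    T x = 1 - x + T (2 * x - 1) / 2 := by
  have := T_add_int (2 * x) (-1)
  push_cast at this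
  rw [T_eq, phi_of_half_le h0 h1, sub_eq_add_neg (2 * x), this]

theorem T_zero : T 0 = 0 := by
  simp [T, phi]

theorem T_int (k : ℤ) : T k = 0 := by
  have := T_add_int 0 k
  rwa [zero_add, T_zero] at this

theorem T_half : T (1 / 2) = 1 / 2 := by
  have := T_int 1
  push_cast at this
  rw [T_of_le_half (by norm_num) le_rfl]
  norm_num [this]

theorem mul_le_T_one_sub (j : ℕ) : ∀ s : ℝ, 0 ≤ s → s ≤ 1 / 2 ^ j → j * s ≤ T (1 - s) := by
  induction j with
  | zero =>
    intro s _ _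
    simpa using T_nonneg (1 - s)
  | succ j ih =>
    intro s h0 h1
    have hpow : (1 : ℝ) / 2 ^ (j + 1) = 1 / 2 ^ j / 2 := by rw [pow_succ]; field_simp
    have hle : (1 : ℝ) / 2 ^ j ≤ 1 :=
      div_le_one_of_le₀ (one_le_pow₀ (by norm_num)) (by positivity)
    have := ih (2 * s) (by linarith) (by linarith)
    rw [T_of_half_le (by linarith) (by linarith),
      show 2 * (1 - s) - 1 = 1 - 2 * s by ring]
    push_cast
    linarith

/-! ### Binary digits -/

theorem eps_mem (n : ℕ) (hn : 1 ≤ n) (x : ℝ) : eps n x = 0 ∨ eps n x = 1 := by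
  obtain ⟨n, rfl⟩ := Nat.exists_eq_add_of_le' hn
  simp only [eps, Nat.add_sub_cancel]
  have h1 := Int.floor_le (2 ^ n * x)
  have h2 := Int.lt_floor_add_one (2 ^ n * x)
  have h3 : 2 * ⌊2 ^ n * x⌋ ≤ ⌊2 ^ (n + 1) * x⌋ := by
    rw [Int.le_floor, pow_succ]
    push_cast
    linarith
  have h4 : ⌊2 ^ (n + 1) * x⌋ < 2 * ⌊2 ^ n * x⌋ + 2 := by
    rw [Int.floor_lt, pow_succ]
    push_cast
    linarith
  omega

theorem D_zero (x : ℝ) : D 0 x = 0 := by simp [D]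

theorem D_succ (n : ℕ) (x : ℝ) : D (n + 1) x = D n x + (1 - 2 * eps (n + 1) x) := by
  rw [D, Finset.sum_Icc_succ_top (by omega), D]

theorem eps_two_mul (n : ℕ) (hn : 1 ≤ n) (x : ℝ) : eps n (2 * x) = eps (n + 1) x := by
  obtain ⟨n, rfl⟩ := Nat.exists_eq_add_of_le' hn
  simp only [eps, Nat.add_sub_cancel]
  rw [show (2 : ℝ) ^ (n + 1) * (2 * x) = 2 ^ (n + 1 + 1) * x by ring,
    show (2 : ℝ) ^ n * (2 * x) = 2 ^ (n + 1) * x by ring]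

theorem D_succ_eq_two_mul (n : ℕ) (x : ℝ) :
    D (n + 1) x = (1 - 2 * eps 1 x) + D n (2 * x) := by
  induction n with
  | zero => simp [D_succ, D_zero]
  | succ n ih =>
    rw [D_succ, ih, D_succ, eps_two_mul (n + 1) (by omega)]
    ring

theorem D_add_int (n : ℕ) (x : ℝ) (k : ℤ) : D n (x + k) = D n x := by
  induction n with
  | zero => simp [D_zero]
  | succ n ih =>
    have h (i : ℕ) : ⌊2 ^ i * (x + k)⌋ = ⌊2 ^ i * x⌋ + 2 ^ i * k := by
      rw [mul_add, ← Int.floor_add_intCast]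
      push_cast
      rfl
    rw [D_succ, D_succ, ih, eps, eps, h, h]
    simp only [Nat.add_sub_cancel, pow_succ]
    ring

theorem eps_one_of_lt_half {x : ℝ} (h0 : 0 ≤ x) (h1 : x < 1 / 2) : eps 1 x = 0 := by
  have h2 : ⌊2 * x⌋ = 0 := Int.floor_eq_iff.2 ⟨by push_cast; linarith, by push_cast; linarith⟩
  have h3 : ⌊x⌋ = 0 := Int.floor_eq_iff.2 ⟨by push_cast; linarith, by push_cast; linarith⟩
  simp [eps, h2, h3]

theorem eps_one_of_half_le {x : ℝ} (h0 : 1 / 2 ≤ x) (h1 : x < 1) : eps 1 x = 1 := by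
  have h2 : ⌊2 * x⌋ = 1 := Int.floor_eq_iff.2 ⟨by push_cast; linarith, by push_cast; linarith⟩
  have h3 : ⌊x⌋ = 0 := Int.floor_eq_iff.2 ⟨by push_cast; linarith, by push_cast; linarith⟩
  simp [eps, h2, h3]

theorem D_succ_of_lt_half (n : ℕ) {x : ℝ} (h0 : 0 ≤ x) (h1 : x < 1 / 2) :
    D (n + 1) x = D n (2 * x) + 1 := by
  rw [D_succ_eq_two_mul, eps_one_of_lt_half h0 h1]
  ring

theorem D_succ_of_half_le (n : ℕ) {x : ℝ} (h0 : 1 / 2 ≤ x) (h1 : x < 1) :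
    D (n + 1) x = D n (2 * x - 1) - 1 := by
  have := D_add_int n (2 * x) (-1)
  push_cast at this
  rw [D_succ_eq_two_mul, eps_one_of_half_le h0 h1, sub_eq_add_neg (2 * x), this]
  ring

theorem D_le (n : ℕ) (x : ℝ) : D n x ≤ n := by
  induction n with
  | zero => simp [D_zero]
  | succ n ih =>
    rw [D_succ]
    push_cast
    rcases eps_mem (n + 1) (by omega) x with h | h <;> omega

theorem D_emod_two (n : ℕ) (x : ℝ) : D n x % 2 = n % 2 := by
  induction n with
  | zero => simp [D_zero]
  | succ n ih =>
    rw [D_succ]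
    push_cast
    omega

theorem D_congr {n : ℕ} {x y : ℝ} (h : ∀ i ≤ n, ⌊2 ^ i * x⌋ = ⌊2 ^ i * y⌋) :
    D n x = D n y := by
  refine Finset.sum_congr rfl fun j hj => ?_
  have := (Finset.mem_Icc.1 hj).2
  rw [eps, eps, h j this, h (j - 1) (by omega)]

theorem exists_D_eq_zero {n : ℕ} (hn : 1 ≤ n) {x : ℝ} (h1 : 0 < D 1 x) (h : D n x ≤ 0) :
    ∃ j, 1 ≤ j ∧ j ≤ n ∧ D j x = 0 := by
  induction n, hn using Nat.le_induction with
  | base => omega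
  | succ n hn ih =>
    by_cases h' : D n x ≤ 0
    · obtain ⟨j, hj1, hj2, hj⟩ := ih h'
      exact ⟨j, hj1, by omega, hj⟩
    · refine ⟨n + 1, by omega, le_rfl, ?_⟩
      rw [D_succ] at h ⊢
      rcases eps_mem (n + 1) (by omega) x with h'' | h'' <;> omega

theorem floor_two_pow_floor (x : ℝ) {i n : ℕ} (h : i ≤ n) :
    ⌊(2 : ℝ) ^ i * (⌊2 ^ n * x⌋ / 2 ^ n)⌋ = ⌊2 ^ i * x⌋ := by
  obtain ⟨c, rfl⟩ := Nat.exists_eq_add_of_le h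
  have e : (2 : ℝ) ^ i * (⌊2 ^ (i + c) * x⌋ / 2 ^ (i + c))
      = (⌊2 ^ (i + c) * x⌋ : ℝ) / ((2 ^ c : ℕ) : ℝ) := by
    push_cast
    rw [pow_add]
    field_simp
  have e' : (2 : ℝ) ^ i * x = 2 ^ (i + c) * x / ((2 ^ c : ℕ) : ℝ) := by
    push_cast
    rw [pow_add]
    field_simp
  rw [e, e', Int.floor_div_natCast, Int.floor_div_natCast, Int.floor_intCast]

/-! ### Affine self-similarity on dyadic intervals -/

theorem phi_dyadic_add (n : ℕ) (k : ℤ) {u : ℝ} (h0 : 0 ≤ u) (h1 : u ≤ 1) :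
    phi ((k + u) / 2 ^ (n + 1)) =
      phi (k / 2 ^ (n + 1)) + u / 2 ^ (n + 1) * (1 - 2 * eps 1 ((k : ℝ) / 2 ^ (n + 1))) := by
  set a : ℝ := k / 2 ^ (n + 1) with ha
  set v : ℝ := u / 2 ^ (n + 1) with hv
  have hp : (0 : ℝ) < 2 ^ n := by positivity
  have hv0 : 0 ≤ v := by positivity
  have hsum : (k + u) / 2 ^ (n + 1) = a + v := add_div _ _ _
  rw [hsum]
  have hfl : ⌊2 * a⌋ = k / 2 ^ n := by
    have : 2 * a = (k : ℝ) / ((2 ^ n : ℕ) : ℝ) := by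
      rw [ha, pow_succ]; push_cast; field_simp
    rw [this, Int.floor_div_natCast, Int.floor_intCast]
    push_cast
    rfl
  have hle : 2 * a + 2 * v ≤ ⌊2 * a⌋ + 1 := by
    have h : k + 1 ≤ (k / 2 ^ n + 1) * 2 ^ n :=
      Int.lt_ediv_add_one_mul_self k (by positivity)
    rw [← hfl] at h
    have h' : (k : ℝ) + 1 ≤ (⌊2 * a⌋ + 1) * 2 ^ n := by exact_mod_cast h
    have : 2 * a + 2 * v = (k + u) / 2 ^ n := by
      rw [ha, hv, pow_succ]; field_simp
    rw [this, div_le_iff₀ hp]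
    linarith
  have hge := Int.floor_le (2 * a)
  have key (t : ℝ) : phi t = phi (t - ⌊a⌋) := by
    rw [← phi_add_int (t - ⌊a⌋) ⌊a⌋, sub_add_cancel]
  have heps : eps 1 a = ⌊2 * a⌋ - 2 * ⌊a⌋ := by simp [eps]
  have hcast : (⌊2 * a⌋ : ℝ) = 2 * ⌊a⌋ + eps 1 a := by
    rw [heps]; push_cast; ring
  rw [hcast] at hle hge
  rw [key (a + v), key a]
  rcases eps_mem 1 le_rfl a with h | h
  · rw [h] at hle hge ⊢
    push_cast at hle hge ⊢
    rw [phi_of_le_half (by linarith) (by linarith), phi_of_le_half (by linarith) (by linarith)]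
    ring
  · rw [h] at hle hge ⊢
    push_cast at hle hge ⊢
    rw [phi_of_half_le (by linarith) (by linarith), phi_of_half_le (by linarith) (by linarith)]
    ring

theorem T_dyadic_add (n : ℕ) (k : ℤ) {u : ℝ} (h0 : 0 ≤ u) (h1 : u ≤ 1) :
    T ((k + u) / 2 ^ n) =
      T (k / 2 ^ n) + u / 2 ^ n * D n ((k : ℝ) / 2 ^ n) + T u / 2 ^ n := by
  induction n with
  | zero => simp [D_zero, T_int, add_comm (k : ℝ) u, T_add_int]
  | succ n ih =>
    have h2 (t : ℝ) : 2 * (t / 2 ^ (n + 1)) = t / 2 ^ n := by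
      rw [pow_succ]; field_simp
    rw [T_eq, T_eq (k / 2 ^ (n + 1)), phi_dyadic_add n k h0 h1, D_succ_eq_two_mul, h2, h2, ih]
    push_cast
    rw [pow_succ]
    field_simp
    ring

/-- Dyadic rationals are local minima of the Takagi function from the left. -/
theorem exists_forall_T_le (n : ℕ) (k : ℤ) (hk : 1 ≤ k) :
    ∃ z : ℝ, 0 ≤ z ∧ z < k / 2 ^ n ∧ ∀ t, z ≤ t → t ≤ k / 2 ^ n → T (k / 2 ^ n) ≤ T t := by
  set d := D n (((k - 1 : ℤ) : ℝ) / 2 ^ n) with hd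
  have hj : (d : ℝ) ≤ d.toNat := by exact_mod_cast Int.self_le_toNat _
  generalize d.toNat = j at hj
  have hs : (0 : ℝ) < 1 / 2 ^ j := by positivity
  have hs1 : (1 : ℝ) / 2 ^ j ≤ 1 := div_le_one_of_le₀ (one_le_pow₀ (by norm_num)) (by positivity)
  have hk' : (1 : ℝ) ≤ k := by exact_mod_cast hk
  have hp : (0 : ℝ) < 2 ^ n := by positivity
  refine ⟨(k - 1 / 2 ^ j) / 2 ^ n, div_nonneg (by linarith) hp.le, ?_, fun t ht0 ht1 => ?_⟩
  · gcongr
    linarith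
  · rw [div_le_iff₀ hp] at ht0
    rw [le_div_iff₀ hp] at ht1
    obtain ⟨s, hst⟩ : ∃ s, s = k - t * 2 ^ n := ⟨_, rfl⟩
    have e1 := T_dyadic_add n (k - 1) (u := 1) (by norm_num) le_rfl
    have e2 := T_dyadic_add n (k - 1) (u := 1 - s) (by linarith) (by linarith)
    have hT1 := T_int 1
    push_cast at hT1
    rw [hT1, show ((k - 1 : ℤ) : ℝ) + 1 = k by push_cast; ring, ← hd, zero_div, add_zero] at e1
    rw [show (((k - 1 : ℤ) : ℝ) + (1 - s)) / 2 ^ n = t by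
      rw [hst]; push_cast; field_simp; ring, ← hd] at e2
    rw [e1, e2]
    have hT := mul_le_T_one_sub j s (by linarith) (by linarith)
    have : 0 ≤ (T (1 - s) - d * s) / 2 ^ n :=
      div_nonneg (by nlinarith) hp.le
    have h3 : (1 - s) / 2 ^ n * d + T (1 - s) / 2 ^ n
        = 1 / 2 ^ n * d + (T (1 - s) - d * s) / 2 ^ n := by
      ring
    linarith

/-! ### Points whose digit walk keeps one sign -/

theorem mul_add_T_le_add (n : ℕ) : ∀ (e : ℤ) (w : ℝ), 0 ≤ w → w < 1 → (∀ j, 1 ≤ e + D j w) →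
    e * w + T w ≤ e + 1 / 2 ^ n := by
  induction n with
  | zero =>
    intro e w h0 h1 h
    have he : (1 : ℝ) ≤ e := by exact_mod_cast (by simpa [D_zero] using h 0)
    have := T_le_one w
    norm_num
    nlinarith
  | succ n ih =>
    intro e w h0 h1 h
    have he : (1 : ℝ) ≤ e := by exact_mod_cast (by simpa [D_zero] using h 0)
    have hpow : (1 : ℝ) / 2 ^ (n + 1) = 1 / 2 ^ n / 2 := by rw [pow_succ]; field_simp
    rcases lt_or_ge w (1 / 2) with hw | hw
    · have := ih (e + 1) (2 * w) (by linarith) (by linarith) fun j => by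
        have := h (j + 1)
        rw [D_succ_of_lt_half j h0 hw] at this
        omega
      rw [T_of_le_half h0 hw.le, hpow]
      push_cast at this
      linarith
    · have := ih (e - 1) (2 * w - 1) (by linarith) (by linarith) fun j => by
        have := h (j + 1)
        rw [D_succ_of_half_le j hw h1] at this
        omega
      rw [T_of_half_le hw h1.le, hpow]
      push_cast at this
      linarith

theorem le_of_forall_le_add_two_pow {a b : ℝ} (h : ∀ n : ℕ, a ≤ b + 1 / 2 ^ n) : a ≤ b := by
  refine le_of_forall_pos_le_add fun ε hε => ?_
  obtain ⟨n, hn⟩ := exists_pow_lt_of_lt_one hε (by norm_num : (1 / 2 : ℝ) < 1)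
  have := h n
  rw [one_div_pow] at hn
  linarith

theorem mul_add_T_le {e : ℤ} {w : ℝ} (h0 : 0 ≤ w) (h1 : w < 1) (h : ∀ j, 1 ≤ e + D j w) :
    e * w + T w ≤ e :=
  le_of_forall_le_add_two_pow fun n => mul_add_T_le_add n e w h0 h1 h

theorem T_le_mul_add (n : ℕ) : ∀ (e : ℤ) (w : ℝ), 0 ≤ w → w < 1 → (∀ j, D j w + 1 ≤ e) →
    T w ≤ e * w + 1 / 2 ^ n := by
  induction n with
  | zero =>
    intro e w h0 h1 h
    have he : (1 : ℝ) ≤ e := by exact_mod_cast (by simpa [D_zero] using h 0)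
    have := T_le_one w
    norm_num
    nlinarith
  | succ n ih =>
    intro e w h0 h1 h
    have he : (1 : ℝ) ≤ e := by exact_mod_cast (by simpa [D_zero] using h 0)
    have hpow : (1 : ℝ) / 2 ^ (n + 1) = 1 / 2 ^ n / 2 := by rw [pow_succ]; field_simp
    rcases lt_or_ge w (1 / 2) with hw | hw
    · have := ih (e - 1) (2 * w) (by linarith) (by linarith) fun j => by
        have := h (j + 1)
        rw [D_succ_of_lt_half j h0 hw] at this
        omega
      rw [T_of_le_half h0 hw.le, hpow]
      push_cast at this
      linarith
    · have := ih (e + 1) (2 * w - 1) (by linarith) (by linarith) fun j => by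
        have := h (j + 1)
        rw [D_succ_of_half_le j hw h1] at this
        omega
      rw [T_of_half_le hw h1.le, hpow]
      push_cast at this
      linarith

theorem T_le_mul {e : ℤ} {w : ℝ} (h0 : 0 ≤ w) (h1 : w < 1) (h : ∀ j, D j w + 1 ≤ e) :
    T w ≤ e * w :=
  le_of_forall_le_add_two_pow fun n => T_le_mul_add n e w h0 h1 h

theorem mul_add_T_lt (n : ℕ) : ∀ (e : ℤ) (w w' : ℝ), 0 ≤ w → w' < 1 → 1 / 2 ^ n ≤ w' - w →
    (∀ j, 1 ≤ e + D j w) → (∀ j, 1 ≤ e + D j w') → (∀ (i : ℕ) (k : ℤ), 2 ^ i * w' ≠ k) →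
    e * w + T w < e * w' + T w' := by
  induction n with
  | zero =>
    intro e w w' h0 h1 hlt
    norm_num at hlt
    linarith
  | succ n ih =>
    intro e w w' h0 h1 hlt h h' hd
    have hpos : (0 : ℝ) < 1 / 2 ^ (n + 1) := by positivity
    have hpow : (1 : ℝ) / 2 ^ (n + 1) = 1 / 2 ^ n / 2 := by rw [pow_succ]; field_simp
    have hd0 (i : ℕ) (k : ℤ) : 2 ^ i * (2 * w') ≠ k := by
      rw [← mul_assoc, ← pow_succ]
      exact hd (i + 1) k
    have hd1 (i : ℕ) (k : ℤ) : 2 ^ i * (2 * w' - 1) ≠ k := fun heq => by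
      apply hd0 i (k + 2 ^ i)
      push_cast
      linarith
    rcases lt_or_ge w (1 / 2) with hw | hw
    · have hs (j : ℕ) : 1 ≤ (e + 1) + D j (2 * w) := by
        have := h (j + 1)
        rw [D_succ_of_lt_half j h0 hw] at this
        omega
      rw [T_of_le_half h0 hw.le]
      rcases lt_or_ge w' (1 / 2) with hw' | hw'
      · have := ih (e + 1) (2 * w) (2 * w') (by linarith) (by linarith) (by linarith) hs
          (fun j => by
            have := h' (j + 1)
            rw [D_succ_of_lt_half j (by linarith) hw'] at this
            omega) hd0
        rw [T_of_le_half (by linarith) hw'.le]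
        push_cast at this
        linarith
      · have he : 2 ≤ e := by
          have := h' 1
          rw [D_succ_of_half_le 0 hw' h1, D_zero] at this
          omega
        have he' : (2 : ℝ) ≤ e := by exact_mod_cast he
        have hbound := mul_add_T_le (by linarith) (by linarith) hs
        push_cast at hbound
        have hne := hd1 0 0
        have hw'' : 1 / 2 < w' := lt_of_le_of_ne hw' fun heq => hne (by rw [← heq]; norm_num)
        have hT := T_nonneg (2 * w' - 1)
        rw [T_of_half_le hw' h1.le]
        nlinarith
    · have hw' : 1 / 2 ≤ w' := by linarith
      have := ih (e - 1) (2 * w - 1) (2 * w' - 1) (by linarith) (by linarith) (by linarith)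
        (fun j => by
          have := h (j + 1)
          rw [D_succ_of_half_le j hw (by linarith)] at this
          omega)
        (fun j => by
          have := h' (j + 1)
          rw [D_succ_of_half_le j hw' h1] at this
          omega) hd1
      rw [T_of_half_le hw (by linarith), T_of_half_le hw' h1.le]
      push_cast at this
      linarith

/-! ### Digit walks of points of `Xstar` -/

/-- If the digit walk of `y` returns to zero by time `n`, then at its first return time `j` the
closed dyadic interval of length `2⁻ʲ` containing `y` misses `Xstar`. -/
theorem exists_forall_notMem_Xstar {y : ℝ} (h0 : 0 ≤ y) (h1 : y < 1) {n : ℕ} (hn : 1 ≤ n)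
    (h : D n y = 0) :
    ∃ j ≤ n, ∀ t : ℝ, ⌊2 ^ j * y⌋ ≤ 2 ^ j * t → 2 ^ j * t ≤ ⌊2 ^ j * y⌋ + 1 → t ∉ Xstar := by
  classical
  have hex : ∃ j, 1 ≤ j ∧ D j y = 0 := ⟨n, hn, h⟩
  obtain ⟨hj1, hj⟩ := Nat.find_spec hex
  have hmin (i : ℕ) (hi1 : 1 ≤ i) (hi : i < Nat.find hex) : D i y ≠ 0 :=
    fun h => Nat.find_min hex hi ⟨hi1, h⟩
  have hle : Nat.find hex ≤ n := Nat.find_min' hex ⟨hn, h⟩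
  generalize Nat.find hex = j at hj1 hj hmin hle
  refine ⟨j, hle, fun t ht0 ht1 ht => ?_⟩
  obtain ⟨m, rfl⟩ : ∃ m, j = 2 * m := by
    have := D_emod_two j y
    exact ⟨j / 2, by omega⟩
  have hp : (0 : ℝ) < 2 ^ (2 * m) := by positivity
  have h4 : (4 : ℝ) ^ m = 2 ^ (2 * m) := by rw [pow_mul]; norm_num
  have hD (i : ℕ) (hi : i ≤ 2 * m) : D i ((⌊2 ^ (2 * m) * y⌋ : ℝ) / 2 ^ (2 * m)) = D i y :=
    D_congr fun l hl => floor_two_pow_floor y (hl.trans hi)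
  refine ht.2 (mem_iUnion₂.2 ⟨(⌊2 ^ (2 * m) * y⌋ : ℝ) / 2 ^ (2 * m), m, mem_iUnion.2
    ⟨⟨⟨⟨?_, ?_⟩, ⟨_, rfl⟩, by rw [hD _ le_rfl, hj]⟩, ?_⟩, ?_, ?_⟩⟩)
  · have : 0 ≤ ⌊2 ^ (2 * m) * y⌋ := Int.floor_nonneg.2 (by positivity)
    have : (0 : ℝ) ≤ ⌊2 ^ (2 * m) * y⌋ := by exact_mod_cast this
    positivity
  · rw [div_lt_one hp]
    exact (Int.floor_le _).trans_lt (by nlinarith)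
  · rw [generation, Finset.card_eq_one]
    refine ⟨2 * m, ?_⟩
    ext i
    simp only [Finset.mem_filter, Finset.mem_Icc, Finset.mem_singleton]
    constructor
    · rintro ⟨⟨hi1, hi2⟩, hi⟩
      rw [hD i hi2] at hi
      by_contra hne
      exact hmin i hi1 (by omega) hi
    · rintro rfl
      exact ⟨⟨hj1, le_rfl⟩, by rw [hD _ le_rfl, hj]⟩
  · rw [div_le_iff₀ hp]
    linarith
  · rw [h4, ← add_div, le_div_iff₀ hp]
    linarith

theorem D_ne_zero_of_mem_Xstar {x : ℝ} (hx : x ∈ Xstar) (h1 : x < 1) {n : ℕ} (hn : 1 ≤ n) :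
    D n x ≠ 0 := fun h => by
  obtain ⟨j, -, hj⟩ := exists_forall_notMem_Xstar hx.1.1 h1 hn h
  exact hj x (Int.floor_le _) (Int.lt_floor_add_one _).le hx

theorem one_le_D_of_mem_Xstar {x : ℝ} (hx : x ∈ Xstar) (h1 : x < 1 / 2) (n : ℕ) :
    1 ≤ D (n + 1) x := by
  by_contra hlt
  obtain ⟨j, hj1, -, hj⟩ := exists_D_eq_zero (n := n + 1) (x := x) (by omega)
    (by rw [D_succ_of_lt_half 0 hx.1.1 h1, D_zero]; norm_num) (by omega)
  exact D_ne_zero_of_mem_Xstar hx (by linarith) hj1 hj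

theorem D_le_neg_one_of_mem_Xstar {x : ℝ} (hx : x ∈ Xstar) (h0 : 1 / 2 ≤ x) (h1 : x < 1) (n : ℕ) :
    D (n + 1) x ≤ -1 := by
  induction n with
  | zero => rw [D_succ_of_half_le 0 h0 h1, D_zero]; norm_num
  | succ n ih =>
    have := D_ne_zero_of_mem_Xstar hx h1 (n := n + 1 + 1) (by omega)
    rw [D_succ] at this ⊢
    rcases eps_mem (n + 1 + 1) (by omega) x with h | h <;> omega

/-- Just to the left of a dyadic rational the digits are eventually all equal to `1`. -/
theorem D_sub_two_pow (n : ℕ) (k : ℤ) (N i : ℕ) (hi : n + i ≤ N) :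
    D (n + i) ((k : ℝ) / 2 ^ n - 1 / 2 ^ N) = D n ((k : ℝ) / 2 ^ n - 1 / 2 ^ N) - i := by
  have hfl (l : ℕ) (hl : n + l ≤ N) :
      ⌊(2 : ℝ) ^ (n + l) * (k / 2 ^ n - 1 / 2 ^ N)⌋ = 2 ^ l * k - 1 := by
    obtain ⟨c, rfl⟩ := Nat.exists_eq_add_of_le hl
    have e : (2 : ℝ) ^ (n + l) * (k / 2 ^ n - 1 / 2 ^ (n + l + c)) = 2 ^ l * k - 1 / 2 ^ c := by
      simp only [pow_add]
      field_simp
    have h1 : (1 : ℝ) / 2 ^ c ≤ 1 :=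
      div_le_one_of_le₀ (one_le_pow₀ (by norm_num)) (by positivity)
    have h2 : (0 : ℝ) < 1 / 2 ^ c := by positivity
    rw [e, Int.floor_eq_iff]
    push_cast
    constructor <;> linarith
  induction i with
  | zero => simp
  | succ i ih =>
    have h1 := hfl (i + 1) hi
    rw [← add_assoc] at h1 hi ⊢
    rw [D_succ, ih (by omega), eps, Nat.add_sub_cancel, h1, hfl i (by omega)]
    push_cast
    ring

theorem two_pow_mul_ne_int_of_mem_Xstar {x : ℝ} (hx : x ∈ Xstar) (h0 : 0 < x) (h1 : x < 1 / 2)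
    (n : ℕ) (k : ℤ) : 2 ^ n * x ≠ k := by
  intro hk
  have hp : (0 : ℝ) < 2 ^ n := by positivity
  have hxk : x = k / 2 ^ n := by rw [← hk]; field_simp
  have hk1 : (1 : ℝ) ≤ k := by
    have : (0 : ℝ) < k := by rw [← hk]; positivity
    exact_mod_cast this
  have hn : 1 ≤ n := by
    by_contra hn
    obtain rfl : n = 0 := by omega
    norm_num at hk
    linarith
  set y : ℝ := (k : ℝ) / 2 ^ n - 1 / 2 ^ (n + n) with hy
  have hq : (0 : ℝ) < 1 / 2 ^ (n + n) := by positivity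
  have hy0 : 0 ≤ y := by
    have h2 : (1 : ℝ) / 2 ^ (n + n) ≤ 1 / 2 ^ n :=
      one_div_le_one_div_of_le hp (pow_le_pow_right₀ (by norm_num) (by omega))
    have h3 : (1 : ℝ) / 2 ^ n ≤ k / 2 ^ n := by gcongr
    linarith
  have hy1 : y < 1 / 2 := by linarith
  have hDy : D (n + n) y ≤ 0 := by
    rw [hy, D_sub_two_pow n k (n + n) n le_rfl]
    have := D_le n ((k : ℝ) / 2 ^ n - 1 / 2 ^ (n + n))
    omega
  obtain ⟨i, hi1, hi2, hi⟩ := exists_D_eq_zero (n := n + n) (x := y) (by omega)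
    (by rw [D_succ_of_lt_half 0 hy0 hy1, D_zero]; norm_num) hDy
  obtain ⟨j, hj, hmiss⟩ := exists_forall_notMem_Xstar hy0 (by linarith) hi1 hi
  have hjN : j ≤ n + n := hj.trans hi2
  refine hmiss x ?_ ?_ hx
  · refine (Int.floor_le _).trans ?_
    gcongr
    linarith
  · obtain ⟨c, hc⟩ := Nat.exists_eq_add_of_le hjN
    have hlt := Int.lt_floor_add_one (2 ^ j * y)
    have hpc : (0 : ℝ) < 2 ^ c := by positivity
    have hpj : (0 : ℝ) < 2 ^ j := by positivity
    have e : 2 ^ c * (2 ^ j * y) = ((2 ^ n * k - 1 : ℤ) : ℝ) := by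
      rw [← mul_assoc, ← pow_add, add_comm c j, ← hc, hy, pow_add]
      push_cast
      field_simp
    have hlt' : ((2 ^ n * k - 1 : ℤ) : ℝ) < ((2 ^ c * (⌊2 ^ j * y⌋ + 1) : ℤ) : ℝ) := by
      rw [← e]
      push_cast
      gcongr
    have hle : 2 ^ n * k ≤ 2 ^ c * (⌊2 ^ j * y⌋ + 1) := by
      have := Int.cast_lt.1 hlt'
      omega
    have hle' : (2 : ℝ) ^ n * k ≤ 2 ^ c * (⌊2 ^ j * y⌋ + 1) := by exact_mod_cast hle
    have e' : 2 ^ c * (2 ^ j * x) = 2 ^ n * k := by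
      rw [← mul_assoc, ← pow_add, add_comm c j, ← hc, hxk, pow_add]
      field_simp
    rw [← e'] at hle'
    exact le_of_mul_le_mul_left hle' hpc

/-! ### The image of `Xstar` -/

theorem one_le_one_add_D_of_mem_Xstar {x : ℝ} (hx : x ∈ Xstar) (h1 : x < 1 / 2) (j : ℕ) :
    1 ≤ (1 : ℤ) + D j (2 * x) := by
  have := one_le_D_of_mem_Xstar hx h1 j
  rw [D_succ_of_lt_half j hx.1.1 h1] at this
  omega

theorem T_le_half_of_mem_Xstar {x : ℝ} (hx : x ∈ Xstar) : T x ≤ 1 / 2 := by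
  have h0 := hx.1.1
  rcases lt_or_ge x (1 / 2) with h | h
  · have := mul_add_T_le (by linarith) (by linarith) (one_le_one_add_D_of_mem_Xstar hx h)
    rw [T_of_le_half h0 h.le]
    push_cast at this
    linarith
  · rcases hx.1.2.eq_or_lt with rfl | h1
    · have := T_int 1
      push_cast at this
      rw [this]
      norm_num
    · have := T_le_mul (e := 1) (w := 2 * x - 1) (by linarith) (by linarith) fun j => by
        have := D_le_neg_one_of_mem_Xstar hx h h1 j
        rw [D_succ_of_half_le j h h1] at this
        omega
      rw [T_of_half_le h h1.le]
      push_cast at this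
      linarith

/-- The infimum of the points `s` with `y ≤ T` on `[s, 1/2]` is a point of `Xstar` at level `y`. -/
theorem exists_mem_Xstar_T_eq {y : ℝ} (hy : y ∈ Icc (0 : ℝ) (1 / 2)) : ∃ x ∈ Xstar, T x = y := by
  set S : Set ℝ := Icc (0 : ℝ) (1 / 2) ∩ ⋂ t : ℝ, {s | y ≤ T (max s (min t (1 / 2)))}
  have hmemS {s : ℝ} (h0 : 0 ≤ s) (h1 : s ≤ 1 / 2) (h : ∀ t, s ≤ t → t ≤ 1 / 2 → y ≤ T t) :
      s ∈ S :=
    ⟨⟨h0, h1⟩, mem_iInter.2 fun t => h _ (le_max_left _ _) (max_le h1 (min_le_right _ _))⟩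
  have hcomp : IsCompact S := isCompact_Icc.inter_right <| isClosed_iInter fun t =>
    isClosed_le continuous_const (continuous_T.comp (continuous_id.max continuous_const))
  have hne : S.Nonempty := ⟨1 / 2, hmemS (by norm_num) le_rfl fun t h0 h1 => by
    rw [le_antisymm h1 h0, T_half]; exact hy.2⟩
  obtain ⟨x, ⟨⟨hx0, hx1⟩, hxS⟩, hleast⟩ := hcomp.exists_isLeast hne
  have hge {t : ℝ} (h0 : x ≤ t) (h1 : t ≤ 1 / 2) : y ≤ T t := by
    have : y ≤ T (max x (min t (1 / 2))) := mem_iInter.1 hxS t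
    rwa [min_eq_left h1, max_eq_right h0] at this
  have hext {z : ℝ} (h0 : 0 ≤ z) (hzx : z ≤ x) (h : ∀ t, z ≤ t → t ≤ x → y ≤ T t) : x ≤ z :=
    hleast (hmemS h0 (hzx.trans hx1) fun t ht0 ht1 =>
      (le_total t x).elim (h t ht0) fun hxt => hge hxt ht1)
  have hxy : T x = y := by
    refine le_antisymm ?_ (hge le_rfl hx1)
    by_contra! hlt
    obtain ⟨ε, hε, hball⟩ := Metric.eventually_nhds_iff.1
      ((continuous_T.tendsto x).eventually (lt_mem_nhds hlt))
    have hxpos : 0 < x := hx0.lt_of_ne fun h => by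
      rw [← h, T_zero] at hlt
      linarith [hy.1]
    have hmax : max 0 (x - ε / 2) < x := max_lt hxpos (by linarith)
    have := hext (le_max_left _ _) hmax.le fun t ht0 ht1 => (hball (by
      have := (le_max_right _ _).trans ht0
      rw [Real.dist_eq, abs_lt]
      constructor <;> linarith)).le
    linarith
  refine ⟨x, ⟨⟨hx0, by linarith⟩, fun hmem => ?_⟩, hxy⟩
  obtain ⟨x₀, m, hmem⟩ := mem_iUnion₂.1 hmem
  obtain ⟨⟨⟨hx₀, ⟨k, hk⟩, hD⟩, hgen⟩, hxI⟩ := mem_iUnion.1 hmem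
  have hp : (0 : ℝ) < 2 ^ (2 * m) := by positivity
  have h4 : (4 : ℝ) ^ m = 2 ^ (2 * m) := by rw [pow_mul]; norm_num
  have hm : m ≠ 0 := by
    rintro rfl
    simp [generation] at hgen
  have hI {t : ℝ} (h0 : x₀ ≤ t) (h1 : t ≤ (k + 1) / 2 ^ (2 * m)) :
      T t = T x₀ + T (2 ^ (2 * m) * t - k) / 2 ^ (2 * m) := by
    rw [hk, div_le_iff₀ hp] at h0
    rw [le_div_iff₀ hp] at h1
    have := T_dyadic_add (2 * m) k (u := 2 ^ (2 * m) * t - k) (by linarith) (by linarith)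
    rw [← hk, hD, add_sub_cancel, mul_div_cancel_left₀ _ hp.ne'] at this
    rw [this]
    simp
  have hIge {t : ℝ} (h0 : x₀ ≤ t) (h1 : t ≤ (k + 1) / 2 ^ (2 * m)) : T x₀ ≤ T t := by
    have hT := div_nonneg (T_nonneg (2 ^ (2 * m) * t - k)) hp.le
    linarith [hI h0 h1]
  have hxr : x ≤ (k + 1) / 2 ^ (2 * m) := by
    have := hxI.2
    rwa [hk, h4, ← add_div] at this
  have hxx₀ : x = x₀ := by
    refine le_antisymm ?_ hxI.1
    rcases le_or_gt ((k + 1 : ℝ) / 2 ^ (2 * m)) (1 / 2) with hr | hr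
    · have hTr : T ((k + 1 : ℝ) / 2 ^ (2 * m)) = T x₀ := by
        have hT1 := T_int 1
        push_cast at hT1
        rw [hI (hxI.1.trans hxr) le_rfl, mul_div_cancel₀ _ hp.ne', add_sub_cancel_left, hT1]
        simp
      exact hext hx₀.1 hxI.1 fun t ht0 ht1 =>
        (hTr ▸ hge hxr hr).trans (hIge ht0 (ht1.trans hxr))
    · obtain ⟨l, hl⟩ : ∃ l, 2 * m = l + 1 := ⟨2 * m - 1, by omega⟩
      rw [lt_div_iff₀ hp, hl, pow_succ] at hr
      have hr' : (2 : ℝ) ^ l < k + 1 := by linarith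
      have hkl : 2 ^ l ≤ k := by
        have : (2 : ℤ) ^ l < k + 1 := by exact_mod_cast hr'
        omega
      have hkl' : (2 : ℝ) ^ l ≤ k := by exact_mod_cast hkl
      refine hx1.trans ?_
      rw [hk, le_div_iff₀ hp, hl, pow_succ]
      linarith
  have hk1 : 1 ≤ k := by
    have hk0 : (0 : ℝ) ≤ k := by
      have := hx₀.1
      rwa [hk, le_div_iff₀ hp, zero_mul] at this
    have hk0 : 0 ≤ k := by exact_mod_cast hk0
    rcases hk0.eq_or_lt with rfl | h
    · have hx₀0 : x₀ = 0 := by simp [hk]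
      rw [hx₀0] at hD
      simp [D, eps] at hD
      omega
    · omega
  obtain ⟨z, hz0, hzlt, hz⟩ := exists_forall_T_le (2 * m) k hk1
  rw [← hk, ← hxx₀] at hzlt hz
  rw [hxy] at hz
  exact hzlt.not_ge (hext hz0 hzlt.le hz)

theorem stmt3 :
    T '' Xstar = Set.Icc (0:ℝ) (1/2) ∧
    ∀ x ∈ Xstar ∩ Set.Ico (0:ℝ) (1/2), ∀ x' ∈ Xstar ∩ Set.Ico (0:ℝ) (1/2),
      x < x' → T x < T x' := by
  refine ⟨Subset.antisymm ?_ fun y hy => exists_mem_Xstar_T_eq hy, ?_⟩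
  · rintro _ ⟨x, hx, rfl⟩
    exact ⟨T_nonneg x, T_le_half_of_mem_Xstar hx⟩
  · rintro x ⟨hx, hx0, hx1⟩ x' ⟨hx', hx0', hx1'⟩ hlt
    obtain ⟨n, hn⟩ := exists_pow_lt_of_lt_one (sub_pos.2 hlt) (by norm_num : (1 / 2 : ℝ) < 1)
    rw [one_div_pow] at hn
    have := mul_add_T_lt n 1 (2 * x) (2 * x') (by linarith) (by linarith) (by linarith)
      (one_le_one_add_D_of_mem_Xstar hx hx1) (one_le_one_add_D_of_mem_Xstar hx' hx1')
      fun i k h => two_pow_mul_ne_int_of_mem_Xstar hx' (by linarith) hx1' (i + 1) k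
        (by rw [← h, pow_succ]; ring)
    rw [T_of_le_half hx0 hx1.le, T_of_le_half hx0' hx1'.le]
    push_cast at this
    linarith
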